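/- Let P be a well-separated, repetitive and expansive L-sub pattern on E with K_P discrete. Then P is non-periodic (equivalently, aperiodic) if and only if the substitution map σ : Ω_P → Ω_P is injective; and in that case the inverse S⁻¹ : Ω_P → LΩ_P of the subdivision map is also an LD map. -/

import Mathlib

open Metric Set Filter Topology Pointwise

variable {E : Type*} [NormedAddCommGroup E] [NormedSpace ℝ E] {S : Type*}

/-- Equality of the `U`-patches of the pattern `P` at `x` and of `Q` at `y`:
`P[x,U] = Q[y,U]`. -/
def PatchEq (P Q : E → S) (x y : E) (U : Set E) : Prop :=
  ∀ u ∈ U, P (x + u) = Q (y + u)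

/-- The translate `P + z` of a pattern `P`. -/
def transl (z : E) (P : E → S) : E → S := fun x => P (x - z)

/-- The distortion `L P` of a pattern `P` by a linear automorphism `L`. -/
def distort (L : E ≃ₗ[ℝ] E) (P : E → S) : E → S := fun x => P (L.symm x)

/-- `Q` is locally indistinguishable from `P` (`Q ≼ P`). -/
def LIfrom (Q P : E → S) : Prop :=
  ∀ U : Set E, IsCompact U → ∀ x : E, ∃ y : E, PatchEq Q P x y U

/-- `P` and `Q` are locally isomorphic (`P ≈ Q`). -/
def LocIso (P Q : E → S) : Prop :=
  LIfrom P Q ∧ LIfrom Q P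

/-- `Q` is locally derivable from `P` (`P ⊳ Q`). -/
def LD (P Q : E → S) : Prop :=
  ∃ c : ℝ, 0 ≤ c ∧ ∀ x y : E, PatchEq P P x y (closedBall 0 c) → Q x = Q y

/-- The group of translational periods of a pattern: `{g | P + g = P}`. -/
def periods (P : E → S) : AddSubgroup E where
  carrier := {g : E | ∀ x : E, P (x + g) = P x}
  zero_mem' := by intro x; rw [add_zero]
  add_mem' := by
    intro a b ha hb
    simp only [Set.mem_setOf_eq] at ha hb ⊢
    intro x
    rw [← add_assoc, hb, ha]
  neg_mem' := by
    intro a ha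
    simp only [Set.mem_setOf_eq] at ha ⊢
    intro x
    have h := ha (x + -a)
    have h2 : x + -a + a = x := by abel
    rw [h2] at h
    exact h.symm

/-- Finite local complexity (FLC) for a single pattern. -/
def IsFLC (P : E → S) : Prop :=
  ∀ U : Set E, IsCompact U → ∃ K : Set E, IsCompact K ∧ ∀ x : E, ∃ v ∈ K, PatchEq P P x v U

/-- Repetitivity for a single pattern. -/
def Repetitive (P : E → S) : Prop :=
  ∀ U : Set E, IsCompact U →
    ∃ R : Set E, IsCompact R ∧ ∀ x y : E, ∃ v ∈ R, PatchEq P P x (y + v) U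

/-- Well-separation for a single pattern. -/
def WellSeparated (P : E → S) : Prop :=
  ∃ V : Set E, IsCompact V ∧ ∀ x y : E, P x ≠ P y →
    ∃ B ∈ 𝓝 (0 : E), ∀ b ∈ B, ∀ b' ∈ B, ¬ PatchEq P P (x + b) (y + b') V

/-- Return discreteness for a single pattern. -/
def ReturnDiscrete (P : E → S) : Prop :=
  ∃ B ∈ 𝓝 (0 : E), ∃ V : Set E, IsCompact V ∧
    ∀ x : E, ∀ b ∈ B, PatchEq P P x (x + b) V → b = 0

/-- The translational hull of a pattern: all patterns locally indistinguishable from it. -/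
def patternHull (P : E → S) : Set (E → S) := {Q | LIfrom Q P}

/-- A pattern space: a nonempty set of patterns closed under being locally
indistinguishable from the collection. -/
def IsPatternSpace (Ω : Set (E → S)) : Prop :=
  Ω.Nonempty ∧ ∀ Q : E → S,
    (∀ U : Set E, IsCompact U → ∀ x : E, ∃ R ∈ Ω, ∃ y : E, PatchEq Q R x y U) → Q ∈ Ω

/-- Finite local complexity for a pattern space. -/
def IsFLCSpace (Ω : Set (E → S)) : Prop :=
  ∀ U : Set E, IsCompact U → ∃ (n : ℕ) (Ps : Fin n → E → S) (Ks : Fin n → Set E),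
    (∀ i, IsCompact (Ks i)) ∧ ∀ Q ∈ Ω, ∀ x : E, ∃ i, ∃ y ∈ Ks i, PatchEq Q (Ps i) x y U

/-- Well-separation for a pattern space. -/
def WellSeparatedSpace (Ω : Set (E → S)) : Prop :=
  ∃ V : Set E, IsCompact V ∧ ∀ P ∈ Ω, ∀ Q ∈ Ω, P 0 ≠ Q 0 →
    ∃ B ∈ 𝓝 (0 : E), ∀ b ∈ B, ∀ b' ∈ B, ¬ PatchEq P Q b b' V

/-- Return discreteness for a pattern space. -/
def ReturnDiscreteSpace (Ω : Set (E → S)) : Prop :=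
  ∃ B ∈ 𝓝 (0 : E), ∃ V : Set E, IsCompact V ∧
    ∀ P ∈ Ω, ∀ b ∈ B, PatchEq P P 0 b V → b = 0

/-- Repetitivity for a pattern space. -/
def RepetitiveSpace (Ω : Set (E → S)) : Prop :=
  ∀ U : Set E, IsCompact U → ∃ R : Set E, IsCompact R ∧
    ∀ P ∈ Ω, ∀ Q ∈ Ω, ∃ v ∈ R, PatchEq P Q 0 v U

/-- A local derivation (LD) map between two sets of patterns. -/
def IsLDMapOn (f : (E → S) → (E → S)) (Ω Ω' : Set (E → S)) : Prop :=
  Set.MapsTo f Ω Ω' ∧ ∃ c : ℝ, 0 ≤ c ∧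
    ∀ P ∈ Ω, ∀ Q ∈ Ω, ∀ x y : E, PatchEq P Q x y (closedBall 0 c) → f P x = f Q y

/-- An expansive linear automorphism (all eigenvalues of modulus strictly greater
than `1`; equivalently, iterates expand uniformly at an exponential rate). -/
def IsExpansive (L : E ≃ₗ[ℝ] E) : Prop :=
  ∃ C > (0 : ℝ), ∃ l > (1 : ℝ), ∀ (n : ℕ) (x : E), C * l ^ n * ‖x‖ ≤ ‖(L ^ n : E ≃ₗ[ℝ] E) x‖

/-- `P` is `L`-sub with predecessor `P'`: `P' ≼ P` and `L P' ⊳ P`. -/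
def IsLSub (L : E ≃ₗ[ℝ] E) (P P' : E → S) : Prop :=
  LIfrom P' P ∧ LD (distort L P') P

/-- An `L`-sub pattern space: `Ω` together with a surjective LD (subdivision) map
`S : L Ω → Ω`. -/
def IsLSubSpace (L : E ≃ₗ[ℝ] E) (Ω : Set (E → S)) (Sub : (E → S) → (E → S)) : Prop :=
  IsLDMapOn Sub (distort L '' Ω) Ω ∧ Set.SurjOn Sub (distort L '' Ω) Ω

/-- The substitution map `σ := S ∘ L`. -/
def substMap (L : E ≃ₗ[ℝ] E) (Sub : (E → S) → (E → S)) : (E → S) → (E → S) :=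
  fun Q => Sub (distort L Q)


theorem LIfrom.trans {P Q R : E → S} (h : LIfrom P Q) (h' : LIfrom Q R) : LIfrom P R := by
  intro U hU x
  obtain ⟨y, hy⟩ := h U hU x
  obtain ⟨z, hz⟩ := h' U hU y
  exact ⟨z, fun u hu => (hy u hu).trans (hz u hu)⟩

theorem LIfrom.refl (P : E → S) : LIfrom P P := fun _ _ x => ⟨x, fun _ _ => rfl⟩

/-- The hull of a repetitive pattern is minimal. -/
theorem Repetitive.lIfrom_of_mem_hull {P Q : E → S} (hP : Repetitive P)
    (hQ : Q ∈ patternHull P) : LIfrom P Q := by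
  intro U hU x
  obtain ⟨R, hR, h⟩ := hP U hU
  obtain ⟨y, hy⟩ := hQ (R + U) (hR.add hU) 0
  obtain ⟨v, hv, hvU⟩ := h x y
  refine ⟨v, fun u hu => ?_⟩
  have := hy (v + u) (Set.add_mem_add hv hu)
  rw [zero_add, ← add_assoc] at this
  rw [hvU u hu, this]

theorem periods_le_of_lIfrom {P Q : E → S} (h : LIfrom P Q) : periods Q ≤ periods P := by
  intro g hg x
  obtain ⟨y, hy⟩ := h {0, g} (Set.toFinite _).isCompact x
  have h0 := hy 0 (by simp)
  have h1 := hy g (by simp)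
  rw [add_zero, add_zero] at h0
  rw [h0, h1]
  exact hg y

/-- The `n`-fold substitution of `Q`, rescaled by `L⁻ⁿ`. -/
def rescaledSubst (L : E ≃ₗ[ℝ] E) (Sub : (E → S) → (E → S)) (n : ℕ) (Q : E → S) : E → S :=
  fun z => (substMap L Sub)^[n] Q ((L ^ n : E ≃ₗ[ℝ] E) z)

theorem linearEquiv_pow_succ_apply (L : E ≃ₗ[ℝ] E) (n : ℕ) (x : E) :
    (L ^ (n + 1) : E ≃ₗ[ℝ] E) x = L ((L ^ n : E ≃ₗ[ℝ] E) x) := by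
  rw [pow_succ']; rfl

theorem mapsTo_substMap {L : E ≃ₗ[ℝ] E} {Sub : (E → S) → (E → S)} {Ω : Set (E → S)}
    (hSub : IsLDMapOn Sub (distort L '' Ω) Ω) : MapsTo (substMap L Sub) Ω Ω :=
  fun _ hQ => hSub.1 (mem_image_of_mem _ hQ)

/-- A single radius controls how every rescaled iterate of substitution depends on every
earlier one. -/
theorem exists_radius_rescaledSubst {L : E ≃ₗ[ℝ] E} (hL : IsExpansive L)
    {Sub : (E → S) → (E → S)} {Ω : Set (E → S)} (hSub : IsLDMapOn Sub (distort L '' Ω) Ω) :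
    ∃ C : ℝ, 0 ≤ C ∧ ∀ m n : ℕ, m ≤ n → ∀ Q ∈ Ω, ∀ R ∈ Ω, ∀ x y : E,
      PatchEq (rescaledSubst L Sub m Q) (rescaledSubst L Sub m R) x y (closedBall 0 C) →
      rescaledSubst L Sub n Q x = rescaledSubst L Sub n R y := by
  obtain ⟨K, hK, l, hl, hexp⟩ := hL
  have hmaps := mapsTo_substMap hSub
  obtain ⟨c, hc, hLD⟩ := hSub.2
  have hl0 : 0 < l := by linarith
  set a : ℕ → ℝ := fun i => c / K * (l⁻¹) ^ (i + 1) with ha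
  have ha0 : ∀ i, 0 ≤ a i := fun i => by positivity
  have hsum : Summable a :=
    (((summable_geometric_of_lt_one (by positivity) (inv_lt_one_of_one_lt₀ hl)).comp_injective
      (add_left_injective 1)).mul_left _)
  have hstep : ∀ n : ℕ, ∀ Q ∈ Ω, ∀ R ∈ Ω, ∀ x y : E,
      PatchEq (rescaledSubst L Sub n Q) (rescaledSubst L Sub n R) x y (closedBall 0 (a n)) →
      rescaledSubst L Sub (n + 1) Q x = rescaledSubst L Sub (n + 1) R y := by
    intro n Q hQ R hR x y h
    have key : ∀ z e : E, L.symm ((L ^ (n + 1) : E ≃ₗ[ℝ] E) z + e) =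
        (L ^ n : E ≃ₗ[ℝ] E) (z + (L ^ (n + 1) : E ≃ₗ[ℝ] E).symm e) := by
      intro z e
      rw [LinearEquiv.symm_apply_eq, ← linearEquiv_pow_succ_apply, map_add,
        LinearEquiv.apply_symm_apply]
    simp only [rescaledSubst, Function.iterate_succ_apply']
    refine hLD _ (mem_image_of_mem _ (hmaps.iterate n hQ)) _
      (mem_image_of_mem _ (hmaps.iterate n hR)) _ _ fun e he => ?_
    simp only [distort, key]
    refine h _ ?_
    have h1 := hexp (n + 1) ((L ^ (n + 1) : E ≃ₗ[ℝ] E).symm e)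
    rw [LinearEquiv.apply_symm_apply] at h1
    rw [mem_closedBall_zero_iff] at he ⊢
    have h2 : a n = c / (K * l ^ (n + 1)) := by
      simp only [ha, inv_pow]
      field_simp
    rw [h2, le_div_iff₀ (by positivity), mul_comm]
    exact h1.trans he
  have hmany : ∀ m k : ℕ, ∀ Q ∈ Ω, ∀ R ∈ Ω, ∀ x y : E,
      PatchEq (rescaledSubst L Sub m Q) (rescaledSubst L Sub m R) x y
        (closedBall 0 (∑ i ∈ Finset.range k, a (m + i))) →
      rescaledSubst L Sub (m + k) Q x = rescaledSubst L Sub (m + k) R y := by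
    intro m k Q hQ R hR
    induction k with
    | zero => intro x y h; simpa using h 0 (by simp)
    | succ k ih =>
      intro x y h
      refine hstep (m + k) Q hQ R hR x y fun u hu => ih _ _ fun w hw => ?_
      rw [add_assoc, add_assoc]
      refine h _ ?_
      rw [mem_closedBall_zero_iff] at hu hw ⊢
      rw [Finset.sum_range_succ]
      linarith [norm_add_le u w]
  refine ⟨∑' i, a i, tsum_nonneg ha0, fun m n hmn Q hQ R hR x y h => ?_⟩
  obtain ⟨k, rfl⟩ := Nat.exists_eq_add_of_le hmn
  refine hmany m k Q hQ R hR x y fun u hu => h u (closedBall_subset_closedBall ?_ hu)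
  have := hsum.sum_le_tsum ((Finset.range k).image (m + ·)) fun i _ => ha0 i
  rwa [Finset.sum_image (by intro i _ j _ hij; simpa using hij)] at this

/-- Rescaled substitutions of a repetitive non-periodic pattern are uniformly repulsive: large
patches do not recur after a small translation. -/
theorem exists_repulsive_radius [FiniteDimensional ℝ E] {L : E ≃ₗ[ℝ] E} (hL : IsExpansive L)
    {P : E → S} (hrep : Repetitive P) {Sub : (E → S) → (E → S)}
    (hSub : IsLDMapOn Sub (distort L '' patternHull P) (patternHull P))
    (hper : periods P = ⊥) :
    ∃ N : ℝ, 0 ≤ N ∧ ∀ (n : ℕ) (g w : E), ‖g‖ ≤ 2 →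
      PatchEq (rescaledSubst L Sub n P) (rescaledSubst L Sub n P) w (w + g) (closedBall 0 N) →
      g = 0 := by
  obtain ⟨C, hC, hloc⟩ := exists_radius_rescaledSubst hL hSub
  have : ProperSpace E := FiniteDimensional.proper ℝ E
  obtain ⟨R, hR, hRP⟩ := hrep _ (isCompact_closedBall (0 : E) (2 + C))
  obtain ⟨N, hN⟩ := hR.isBounded.subset_closedBall (0 : E)
  refine ⟨max N 0, le_max_right _ _, fun n g w hg h => ?_⟩
  have hPP : P ∈ patternHull P := LIfrom.refl P
  have hinv : ∀ y, rescaledSubst L Sub n P (y + g) = rescaledSubst L Sub n P y := by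
    intro y
    obtain ⟨v, hv, hvP⟩ := hRP y w
    have key : ∀ u : E, ‖u‖ ≤ 2 →
        rescaledSubst L Sub n P (y + u) = rescaledSubst L Sub n P (w + v + u) := by
      intro u hu
      refine hloc 0 n (Nat.zero_le n) P hPP P hPP _ _ fun e he => ?_
      simp only [rescaledSubst, pow_zero, Function.iterate_zero, id, LinearEquiv.coe_one]
      rw [add_assoc, add_assoc _ u e]
      refine hvP _ ?_
      rw [mem_closedBall_zero_iff] at he ⊢
      linarith [norm_add_le u e]
    have h0 := key 0 (by simp)
    rw [add_zero, add_zero] at h0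
    rw [key g hg, h0, h v (closedBall_subset_closedBall (le_max_left _ _) (hN hv)),
      add_right_comm]
  have hmem : (L ^ n : E ≃ₗ[ℝ] E) g ∈ periods ((substMap L Sub)^[n] P) := by
    intro x
    have := hinv ((L ^ n : E ≃ₗ[ℝ] E).symm x)
    simpa [rescaledSubst] using this
  have hn : (substMap L Sub)^[n] P ∈ patternHull P := (mapsTo_substMap hSub).iterate n hPP
  have := periods_le_of_lIfrom (hrep.lIfrom_of_mem_hull hn) hmem
  rw [hper] at this
  simpa using this

/-- Recognizability: the distorted predecessor of a non-periodic repetitive expansive `L`-sub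
pattern is locally derivable from the pattern. -/
theorem lD_distort_predecessor [FiniteDimensional ℝ E] {L : E ≃ₗ[ℝ] E} (hL : IsExpansive L)
    {P P' : E → S} (hrep : Repetitive P) (hP' : LIfrom P' P) {Sub : (E → S) → (E → S)}
    (hSub : IsLDMapOn Sub (distort L '' patternHull P) (patternHull P))
    (hSubP : Sub (distort L P') = P) (hper : periods P = ⊥) : LD P (distort L P') := by
  obtain ⟨C, hC, hloc⟩ := exists_radius_rescaledSubst hL hSub
  obtain ⟨N, hN, hrepul⟩ := exists_repulsive_radius hL hrep hSub hper
  have : ProperSpace E := FiniteDimensional.proper ℝ E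
  have hPP : P ∈ patternHull P := LIfrom.refl P
  have hiter : ∀ n, (substMap L Sub)^[n] P ∈ patternHull P :=
    fun n => (mapsTo_substMap hSub).iterate n hPP
  set F : ℕ → E → S := fun n => rescaledSubst L Sub n P with hF
  set H : ℝ := N + 1 + C with hH
  have hbound : ∀ n : ℕ, ∃ c : ℝ, 0 ≤ c ∧ ∀ u : E, ‖u‖ ≤ H → ‖(L ^ n : E ≃ₗ[ℝ] E) u‖ ≤ c := by
    intro n
    obtain ⟨c, hc⟩ := ((isCompact_closedBall (0 : E) H).image
      (L ^ n : E ≃ₗ[ℝ] E).toLinearMap.continuous_of_finiteDimensional).isBounded.subset_closedBall 0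
    refine ⟨max c 0, le_max_right _ _, fun u hu => (?_ : _ ≤ c).trans (le_max_left _ _)⟩
    simpa using hc (mem_image_of_mem _ (mem_closedBall_zero_iff.2 hu))
  obtain ⟨K, hK, hKP⟩ := hrep _ (isCompact_closedBall (0 : E) (H + C))
  have hmodel : ∀ (n : ℕ) (x : E), ∃ v ∈ K, F n v = P' x ∧
      ∀ u : E, ‖u‖ ≤ H → F (n + 1) (v + u) = P (L x + (L ^ (n + 1) : E ≃ₗ[ℝ] E) u) := by
    intro n x
    obtain ⟨c, hc, hcH⟩ := hbound n
    obtain ⟨a, ha⟩ := (hP'.trans (hrep.lIfrom_of_mem_hull (hiter n))) _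
      (isCompact_closedBall (0 : E) (c + C)) x
    obtain ⟨b, rfl⟩ := (L ^ n : E ≃ₗ[ℝ] E).surjective a
    obtain ⟨v, hv, hvP⟩ := hKP b 0
    rw [zero_add] at hvP
    have hvF : ∀ k : ℕ, ∀ u : E, ‖u‖ ≤ H → F k (v + u) = F k (b + u) := by
      intro k u hu
      refine hloc 0 k (Nat.zero_le k) P hPP P hPP _ _ fun e he => ?_
      simp only [rescaledSubst, pow_zero, Function.iterate_zero, id, LinearEquiv.coe_one]
      rw [add_assoc, add_assoc _ u e]
      refine (hvP _ ?_).symm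
      rw [mem_closedBall_zero_iff] at he ⊢
      linarith [norm_add_le u e]
    refine ⟨v, hv, ?_, fun u hu => ?_⟩
    · have h0 := hvF n 0 (by simp; positivity)
      rw [add_zero, add_zero] at h0
      have h1 := ha 0 (by simp; positivity)
      rw [add_zero, add_zero] at h1
      rw [h0, h1]
      rfl
    · rw [hvF (n + 1) u hu]
      have h1 : rescaledSubst L Sub 1 P' (x + (L ^ n : E ≃ₗ[ℝ] E) u) =
          rescaledSubst L Sub 1 ((substMap L Sub)^[n] P)
            ((L ^ n : E ≃ₗ[ℝ] E) b + (L ^ n : E ≃ₗ[ℝ] E) u) := by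
        refine hloc 0 1 zero_le_one P' hP' _ (hiter n) _ _ fun e he => ?_
        simp only [rescaledSubst, pow_zero, Function.iterate_zero, id, LinearEquiv.coe_one]
        rw [add_assoc, add_assoc _ _ e]
        refine ha _ ?_
        rw [mem_closedBall_zero_iff] at he ⊢
        linarith [norm_add_le ((L ^ n : E ≃ₗ[ℝ] E) u) e, hcH u hu]
      simp only [rescaledSubst, pow_one, Function.iterate_one, map_add,
        ← linearEquiv_pow_succ_apply] at h1
      simp only [hF, rescaledSubst, map_add, Function.iterate_succ_apply']
      rw [← h1]
      simp only [substMap, hSubP]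
  by_contra hcon
  simp only [LD, not_exists, not_and, not_forall] at hcon
  have hpairs : ∀ n : ℕ, ∃ p : E × E, p ∈ K ×ˢ K ∧ F n p.1 ≠ F n p.2 ∧
      ∀ u : E, ‖u‖ ≤ H → F (n + 1) (p.1 + u) = F (n + 1) (p.2 + u) := by
    intro n
    obtain ⟨c, hc, hcH⟩ := hbound (n + 1)
    obtain ⟨x, y, hxy, hne⟩ := hcon c hc
    obtain ⟨v, hv, hv0, hvF⟩ := hmodel n (L.symm x)
    obtain ⟨w, hw, hw0, hwF⟩ := hmodel n (L.symm y)
    refine ⟨(v, w), ⟨hv, hw⟩, ?_, fun u hu => ?_⟩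
    · rw [hv0, hw0]
      exact hne
    · simp only [hvF u hu, hwF u hu, LinearEquiv.apply_symm_apply]
      exact hxy _ (mem_closedBall_zero_iff.2 (hcH u hu))
  choose p hpK hpne hpF using hpairs
  obtain ⟨q, -, φ, hφ, hlim⟩ := (hK.prod hK).tendsto_subseq hpK
  obtain ⟨j, hj⟩ := Metric.cauchySeq_iff'.1 hlim.cauchySeq 1 one_pos
  have hclose := hj (j + 1) (Nat.le_succ j)
  set m := φ j
  set n := φ (j + 1)
  have hmn : m + 1 ≤ n := hφ (Nat.lt_succ_self j)
  rw [Function.comp_apply, Function.comp_apply, Prod.dist_eq, max_lt_iff, dist_eq_norm,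
    dist_eq_norm] at hclose
  obtain ⟨hd1, hd2⟩ := hclose
  have hprop : ∀ k, m + 1 ≤ k → ∀ u : E, ‖u‖ ≤ N + 1 →
      F k ((p m).1 + u) = F k ((p m).2 + u) := by
    intro k hk u hu
    refine hloc (m + 1) k hk P hPP P hPP _ _ fun e he => ?_
    rw [add_assoc, add_assoc _ u e]
    refine hpF m _ ?_
    rw [mem_closedBall_zero_iff] at he
    linarith [norm_add_le u e]
  set d := (p n).1 - (p m).1 with hd
  have hg : (p m).2 + d - (p n).2 = 0 := by
    refine hrepul (n + 1) _ (p n).2 ?_ fun z hz => ?_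
    · have : (p m).2 + d - (p n).2 = d - ((p n).2 - (p m).2) := by abel
      rw [this]
      linarith [norm_sub_le d ((p n).2 - (p m).2)]
    · rw [mem_closedBall_zero_iff] at hz
      have h1 := hpF n z (by linarith)
      have h2 := hprop (n + 1) (by omega) (d + z) (by linarith [norm_add_le d z])
      have e1 : (p m).1 + (d + z) = (p n).1 + z := by rw [hd]; abel
      have e2 : (p n).2 + ((p m).2 + d - (p n).2) + z = (p m).2 + (d + z) := by abel
      rw [e1] at h2
      rw [e2]
      exact h1.symm.trans h2
  have h3 := hprop n hmn d (by linarith)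
  have e1 : (p m).1 + d = (p n).1 := by rw [hd]; abel
  rw [e1, sub_eq_zero.1 hg] at h3
  exact hpne n h3

/-- If substitution is injective on the hull of a repetitive expansive `L`-sub pattern with
discrete periods, then the pattern is non-periodic. -/
theorem periods_eq_bot_of_injOn_substMap {L : E ≃ₗ[ℝ] E} (hL : IsExpansive L)
    {P P' : E → S} (hrep : Repetitive P) (hP' : LIfrom P' P)
    (hdisc : DiscreteTopology ↥(periods P)) {Sub : (E → S) → (E → S)}
    (hSub : IsLDMapOn Sub (distort L '' patternHull P) (patternHull P))
    (hSubP : Sub (distort L P') = P) (hinj : InjOn (substMap L Sub) (patternHull P)) :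
    periods P = ⊥ := by
  obtain ⟨c, hc, hLD⟩ := hSub.2
  have hdesc : ∀ h : E, L h ∈ periods P → h ∈ periods P := by
    intro h hh
    refine periods_le_of_lIfrom (hrep.lIfrom_of_mem_hull hP') ?_
    have hR : (fun x => P' (x + h)) ∈ patternHull P := by
      intro U hU x
      obtain ⟨y, hy⟩ := hP' U hU (x + h)
      exact ⟨y, fun u hu => by rw [← hy u hu, add_right_comm]⟩
    refine fun x => congrFun (hinj hR hP' (funext fun z => ?_)) x
    have : substMap L Sub (fun x => P' (x + h)) z = substMap L Sub P' (z + L h) := by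
      refine hLD _ (mem_image_of_mem _ hR) _ (mem_image_of_mem _ hP') _ _ fun u _ => ?_
      simp only [distort, map_add, LinearEquiv.symm_apply_apply]
      rw [add_right_comm]
    rw [this]
    simp only [substMap, hSubP]
    exact hh z
  have hdescn : ∀ (n : ℕ) (h : E), (L ^ n : E ≃ₗ[ℝ] E) h ∈ periods P → h ∈ periods P := by
    intro n
    induction n with
    | zero => intro h hh; simpa using hh
    | succ n ih =>
      intro h hh
      rw [linearEquiv_pow_succ_apply] at hh
      exact ih h (hdesc _ hh)
  obtain ⟨K, hK, l, hl, hexp⟩ := hL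
  have hl0 : 0 < l := by linarith
  obtain ⟨ε, hε, hball⟩ := Metric.isOpen_iff.1
    (isOpen_discrete ({0} : Set ↥(periods P))) 0 rfl
  rw [eq_bot_iff]
  intro g hg
  obtain ⟨n, hn⟩ := pow_unbounded_of_one_lt (‖g‖ / (K * ε)) hl
  have hmem : (L ^ n : E ≃ₗ[ℝ] E).symm g ∈ periods P := hdescn n _ (by simpa using hg)
  have hzero : (⟨_, hmem⟩ : ↥(periods P)) ∈ ({0} : Set ↥(periods P)) := by
    refine hball ?_
    rw [mem_ball, Subtype.dist_eq]
    have h1 := hexp n ((L ^ n : E ≃ₗ[ℝ] E).symm g)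
    rw [LinearEquiv.apply_symm_apply] at h1
    rw [div_lt_iff₀ (by positivity)] at hn
    simp only [AddSubgroup.coe_zero, dist_zero_right]
    refine lt_of_mul_lt_mul_left (h1.trans_lt ?_) (by positivity : 0 ≤ K * l ^ n)
    linarith
  have h0 : (L ^ n : E ≃ₗ[ℝ] E).symm g = 0 := congrArg Subtype.val hzero
  simpa using h0

/-- If the distorted predecessor is locally derivable from `P`, then the subdivision map has an
inverse that is an LD map. -/
theorem exists_lD_inverse {L : E ≃ₗ[ℝ] E} [FiniteDimensional ℝ E]
    {P P' : E → S} (hrep : Repetitive P) (hP' : LIfrom P' P) {Sub : (E → S) → (E → S)}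
    (hSub : IsLDMapOn Sub (distort L '' patternHull P) (patternHull P))
    (hSubP : Sub (distort L P') = P) (hLD : LD P (distort L P')) :
    ∃ g : (E → S) → (E → S),
      IsLDMapOn g (patternHull P) (distort L '' patternHull P) ∧
      ∀ Q ∈ distort L '' patternHull P, g (Sub Q) = Q := by
  classical
  obtain ⟨c, hc, hder⟩ := hLD
  obtain ⟨r, hr, hSubr⟩ := hSub.2
  have : ProperSpace E := FiniteDimensional.proper ℝ E
  have hcont : Continuous (L : E → E) := L.toLinearMap.continuous_of_finiteDimensional
  have hcont' : Continuous (L.symm : E → E) :=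
    L.symm.toLinearMap.continuous_of_finiteDimensional
  let g : (E → S) → (E → S) := fun Q x =>
    if h : ∃ y, PatchEq Q P x y (closedBall 0 c) then distort L P' h.choose else Q x
  have hg : ∀ (Q : E → S) (x y : E), PatchEq Q P x y (closedBall 0 c) →
      g Q x = distort L P' y := by
    intro Q x y h
    have hex : ∃ y, PatchEq Q P x y (closedBall 0 c) := ⟨y, h⟩
    simp only [g, dif_pos hex]
    exact hder _ _ fun u hu => (hex.choose_spec u hu).symm.trans (h u hu)
  refine ⟨g, ⟨fun Q hQ => ⟨fun x => g Q (L x), ?_, ?_⟩, c, hc, ?_⟩, ?_⟩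
  · refine LIfrom.trans (Q := P') (fun U hU x => ?_) hP'
    obtain ⟨y, hy⟩ := hQ (L '' U + closedBall 0 c)
      ((hU.image hcont).add (isCompact_closedBall 0 c)) (L x)
    refine ⟨L.symm y, fun u hu => ?_⟩
    change g Q (L (x + u)) = _
    rw [hg Q (L (x + u)) (y + L u)]
    · simp [distort]
    · intro e he
      rw [map_add, add_assoc, add_assoc]
      exact hy _ (Set.add_mem_add (mem_image_of_mem _ hu) he)
  · funext x
    simp [distort]
  · intro Q hQ R hR x y h
    obtain ⟨z, hz⟩ := hR _ (isCompact_closedBall 0 c) y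
    rw [hg R y z hz, hg Q x z fun u hu => (h u hu).trans (hz u hu)]
  · rintro _ ⟨R, hR, rfl⟩
    funext x
    obtain ⟨z, hz⟩ := (LIfrom.trans hR (hrep.lIfrom_of_mem_hull hP'))
      (L.symm '' (closedBall 0 c + closedBall 0 r))
      (((isCompact_closedBall 0 c).add (isCompact_closedBall 0 r)).image hcont') (L.symm x)
    rw [hg _ x (L z)]
    · have h0 := hz 0 ⟨0, ⟨0, by simpa, 0, by simpa, by simp⟩, by simp⟩
      simpa [distort] using h0.symm
    · intro u hu
      rw [← congrFun hSubP (L z + u)]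
      refine hSubr _ (mem_image_of_mem _ hR) _ (mem_image_of_mem _ hP') _ _ fun e he => ?_
      simp only [distort, add_assoc]
      have := hz (L.symm (u + e)) (mem_image_of_mem _ (Set.add_mem_add hu he))
      simpa only [map_add, LinearEquiv.symm_apply_apply] using this

/-- Theorem: a well-separated, repetitive, expansive `L`-sub pattern with discrete group
of periods is non-periodic iff substitution on its hull is injective; in that case the
inverse of the subdivision map is also an LD map. -/
theorem stmt4 [FiniteDimensional ℝ E] (L : E ≃ₗ[ℝ] E) (hL : IsExpansive L)
    (P P' : E → S) (hWS : WellSeparated P) (hrep : Repetitive P)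
    (hsub : IsLSub L P P') (hdisc : DiscreteTopology ↥(periods P))
    (Sub : (E → S) → (E → S))
    (hSubLD : IsLDMapOn Sub (distort L '' patternHull P) (patternHull P))
    (hSubP : Sub (distort L P') = P) :
    (periods P = ⊥ ↔ Set.InjOn (substMap L Sub) (patternHull P)) ∧
    (periods P = ⊥ →
      ∃ g : (E → S) → (E → S),
        IsLDMapOn g (patternHull P) (distort L '' patternHull P) ∧
        ∀ Q ∈ distort L '' patternHull P, g (Sub Q) = Q) := by
  have hinv (hper : periods P = ⊥) := exists_lD_inverse hrep hsub.1 hSubLD hSubP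
    (lD_distort_predecessor hL hrep hsub.1 hSubLD hSubP hper)
  refine ⟨⟨fun hper Q hQ R hR hQR => ?_, fun hinj =>
    periods_eq_bot_of_injOn_substMap hL hrep hsub.1 hdisc hSubLD hSubP hinj⟩, hinv⟩
  obtain ⟨g, -, hg⟩ := hinv hper
  have h : distort L Q = distort L R := by
    rw [← hg _ (mem_image_of_mem _ hQ), ← hg _ (mem_image_of_mem _ hR)]
    exact congrArg g hQR
  funext x
  simpa [distort] using congrFun h (L x)
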